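/- The set of positive integers n with Möbius function value μ(n) = -1 (i.e., squarefree n with an odd number of prime factors) has natural density 3/π²; that is, (1/n)·#{i : 1 ≤ i ≤ n, μ(i) = -1} tends to 3/π² as n → ∞. -/

import Mathlib

open Filter Real

open scoped FourierTransform Topology SchwartzMap
open MeasureTheory

theorem SchwartzMap.integral_fourier_mul_eq_of_integrable (ψ : 𝓢(ℝ, ℂ)) {g : ℝ → ℂ}
    (hg : Integrable g) : ∫ v, 𝓕 ψ v * g v = ∫ y, ψ y * 𝓕 g y := by
  have h := VectorFourier.integral_fourierIntegral_smul_eq_flip (μ := volume) (ν := volume)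
    (L := innerₗ ℝ) Real.continuous_fourierChar continuous_inner ψ.integrable hg
  simpa [smul_eq_mul, flip_innerₗ] using! h

theorem SchwartzMap.exists_hasCompactSupport_apply_zero_eq_one :
    ∃ ψ : 𝓢(ℝ, ℂ), HasCompactSupport ψ ∧ ψ 0 = 1 := by
  let b : ContDiffBump (0 : ℝ) := ⟨1, 2, by norm_num, by norm_num⟩
  have hc : HasCompactSupport fun x : ℝ => ((b x : ℝ) : ℂ) :=
    b.hasCompactSupport.comp_left Complex.ofReal_zero
  refine ⟨hc.toSchwartzMap (Complex.ofRealCLM.contDiff.comp b.contDiff), hc, ?_⟩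
  change ((b 0 : ℝ) : ℂ) = 1
  rw [b.one_of_mem_closedBall (by simp [b])]
  simp

theorem SchwartzMap.integral_fourier (ψ : 𝓢(ℝ, ℂ)) : ∫ v, 𝓕 ψ v = ψ 0 := by
  have h : 𝓕⁻ (𝓕 (ψ : ℝ → ℂ)) = ψ :=
    ψ.continuous.fourierInv_fourier_eq ψ.integrable (𝓕 ψ).integrable
  have h0 := congrFun h 0
  rw [Real.fourierInv_eq] at h0
  simpa using! h0

theorem integrable_cexp_neg_mul_mul {f : ℝ → ℂ} (hm : Measurable f) (hb : ∀ t, ‖f t‖ ≤ 1)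
    (h0 : ∀ t < 0, f t = 0) {z : ℂ} (hz : 0 < z.re) :
    Integrable fun t : ℝ => Complex.exp (-(z * t)) * f t := by
  have hi : Integrable ((Set.Ici (0 : ℝ)).indicator fun t => Real.exp (-z.re * t)) := by
    rw [integrable_indicator_iff measurableSet_Ici, integrableOn_Ici_iff_integrableOn_Ioi]
    exact exp_neg_integrableOn_Ioi 0 hz
  refine hi.mono' (by fun_prop) (Eventually.of_forall fun t => ?_)
  rcases lt_or_ge t 0 with ht | ht
  · simp [h0 t ht, Set.indicator, ht.not_ge]
  · rw [Set.indicator_of_mem (Set.mem_Ici.2 ht), norm_mul, Complex.norm_exp]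
    simpa using mul_le_of_le_one_right (Real.exp_pos _).le (hb t)

theorem tendsto_integral_fourier_mul_comp_sub {f : ℝ → ℂ} (hm : Measurable f)
    (hb : ∀ t, ‖f t‖ ≤ 1) (h0 : ∀ t < 0, f t = 0) {G : ℂ → ℂ}
    (hG : ContinuousOn G {z | 0 ≤ z.re})
    (hL : ∀ z : ℂ, 0 < z.re → ∫ t : ℝ, Complex.exp (-(z * t)) * f t = G z)
    (ψ : 𝓢(ℝ, ℂ)) (hψ : HasCompactSupport ψ) :
    Tendsto (fun T : ℝ => ∫ v, 𝓕 ψ v * f (T - v)) atTop (𝓝 0) := by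
  let γ : ℝ → ℝ → ℂ := fun ε y => (ε : ℂ) - 2 * π * y * Complex.I
  have hγ (ε y) : (γ ε y).re = ε := by simp [γ]
  have hintegral (T : ℝ) : ∫ v, 𝓕 ψ v * f (T - v) = ∫ y, 𝐞 (-(y * T)) • (ψ y * G (γ 0 y)) := by
    have hparseval (ε : ℝ) (hε : 0 < ε) :
        ∫ v, 𝓕 ψ v * (Complex.exp (-(ε * (T - v : ℝ))) * f (T - v)) =
          ∫ y, ψ y * (𝐞 (-(y * T)) * G (γ ε y)) := by
      have hi := integrable_cexp_neg_mul_mul hm hb h0 (z := ε) (by simpa)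
      rw [ψ.integral_fourier_mul_eq_of_integrable (hi.comp_sub_left T)]
      congr 1 with y
      congr 1
      rw [Real.fourier_real_eq, ← integral_sub_left_eq_self _ volume T, ← hL _ (by simpa [hγ]),
        ← integral_const_mul]
      congr 1 with v
      simp only [Circle.smul_def, Real.fourierChar_apply, smul_eq_mul, sub_sub_cancel,
        ← mul_assoc, ← Complex.exp_add]
      congr 2
      simp only [γ]
      push_cast
      ring
    have hu : Tendsto (fun n : ℕ => 1 / ((n : ℝ) + 1)) atTop (𝓝 0) :=
      tendsto_one_div_add_atTop_nhds_zero_nat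
    have hu0 (n : ℕ) : 0 < 1 / ((n : ℝ) + 1) := by positivity
    have hu1 (n : ℕ) : 1 / ((n : ℝ) + 1) ≤ 1 := by
      rw [div_le_one (by positivity)]; linarith [n.cast_nonneg (α := ℝ)]
    have hl : Tendsto (fun n : ℕ =>
        ∫ v, 𝓕 ψ v * (Complex.exp (-((1 / ((n : ℝ) + 1) : ℝ) * (T - v : ℝ))) * f (T - v)))
        atTop (𝓝 (∫ v, 𝓕 ψ v * f (T - v))) := by
      refine tendsto_integral_filter_of_dominated_convergence (fun v => ‖𝓕 ψ v‖)
        (Eventually.of_forall fun n => ?_) (Eventually.of_forall fun n =>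
          Eventually.of_forall fun v => ?_) (𝓕 ψ).integrable.norm
        (Eventually.of_forall fun v => ?_)
      · exact (𝓕 ψ).continuous.aestronglyMeasurable.mul (by fun_prop)
      · rw [norm_mul]
        refine mul_le_of_le_one_right (norm_nonneg _) ?_
        rcases lt_or_ge (T - v) 0 with ht | ht
        · simp [h0 _ ht]
        · rw [norm_mul, ← Complex.ofReal_mul, ← Complex.ofReal_neg, Complex.norm_exp_ofReal]
          refine mul_le_one₀ (Real.exp_le_one_iff.2 ?_) (norm_nonneg _) (hb _)
          exact neg_nonpos.2 (mul_nonneg (hu0 n).le ht)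
      · have hc : Continuous fun ε : ℝ =>
            𝓕 ψ v * (Complex.exp (-((ε : ℝ) * (T - v : ℝ))) * f (T - v)) := by fun_prop
        simpa [Function.comp_def] using (hc.tendsto 0).comp hu
    have hr : Tendsto (fun n : ℕ => ∫ y, ψ y * (𝐞 (-(y * T)) * G (γ (1 / ((n : ℝ) + 1)) y)))
        atTop (𝓝 (∫ y, ψ y * (𝐞 (-(y * T)) * G (γ 0 y)))) := by
      have hcont : ContinuousOn (fun p : ℝ × ℝ => G (γ p.1 p.2))
          (Set.Icc 0 1 ×ˢ tsupport ψ) := by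
        refine hG.comp (by fun_prop) fun p hp => ?_
        simpa [hγ] using hp.1.1
      obtain ⟨B, hB⟩ := (isCompact_Icc.prod hψ.isCompact).exists_bound_of_continuousOn hcont
      have hGc (ε : ℝ) (hε : 0 ≤ ε) : Continuous fun y => G (γ ε y) :=
        hG.comp_continuous (by fun_prop) fun y => by simpa [hγ] using hε
      refine tendsto_integral_filter_of_dominated_convergence (fun y => ‖ψ y‖ * B)
        (Eventually.of_forall fun n => ?_) (Eventually.of_forall fun n =>
          Eventually.of_forall fun y => ?_) (ψ.integrable.norm.mul_const B)
        (Eventually.of_forall fun y => ?_)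
      · have := hGc _ (hu0 n).le
        have hchar : Continuous fun y : ℝ => (𝐞 (-(y * T)) : ℂ) :=
          continuous_subtype_val.comp (Real.continuous_fourierChar.comp (by fun_prop))
        exact (ψ.continuous.mul (hchar.mul this)).aestronglyMeasurable
      · rw [norm_mul, norm_mul, Circle.norm_coe, one_mul]
        by_cases hy : y ∈ tsupport ψ
        · exact mul_le_mul_of_nonneg_left (hB (_, y) ⟨⟨(hu0 n).le, hu1 n⟩, hy⟩) (norm_nonneg _)
        · simp [image_eq_zero_of_notMem_tsupport hy]
      · have hγt : Tendsto (fun n : ℕ => γ (1 / ((n : ℝ) + 1)) y) atTop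
            (𝓝[{z | 0 ≤ z.re}] (γ 0 y)) := by
          refine tendsto_nhdsWithin_iff.2 ⟨?_, Eventually.of_forall fun n => ?_⟩
          · have hc : Continuous fun ε => γ ε y := by fun_prop
            exact (hc.tendsto 0).comp hu
          · simpa [hγ] using (hu0 n).le
        have hGt := (hG (γ 0 y) (by simp [hγ])).tendsto.comp hγt
        exact (hGt.const_mul _).const_mul _
    have := tendsto_nhds_unique (hl.congr fun n => hparseval _ (hu0 n)) hr
    rw [this]
    congr 1 with y
    rw [Circle.smul_def, smul_eq_mul]
    ring
  simp_rw [hintegral]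
  exact (Real.tendsto_integral_exp_smul_cocompact fun y => ψ y * G (γ 0 y)).mono_left
    atTop_le_cocompact

theorem tendsto_zero_of_laplace_continuousOn {f : ℝ → ℂ} (hm : Measurable f)
    (hb : ∀ t, ‖f t‖ ≤ 1) (h0 : ∀ t < 0, f t = 0) {G : ℂ → ℂ}
    (hG : ContinuousOn G {z | 0 ≤ z.re})
    (hL : ∀ z : ℂ, 0 < z.re → ∫ t : ℝ, Complex.exp (-(z * t)) * f t = G z)
    {C : ℝ} {δ : ℝ → ℝ} (hδ : Tendsto δ atTop (𝓝 0))
    (hf : ∀ s t, ‖f t - f s‖ ≤ C * |t - s| + δ t) :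
    Tendsto f atTop (𝓝 0) := by
  obtain ⟨ψ, hψ, hψ0⟩ := SchwartzMap.exists_hasCompactSupport_apply_zero_eq_one
  set A := ∫ v, ‖𝓕 ψ v‖ with hA
  set B := ∫ v, |v| * ‖𝓕 ψ v‖ with hB
  have hBi : Integrable fun v : ℝ => |v| * ‖𝓕 ψ v‖ := 
    ((𝓕 ψ).integrable_pow_mul volume 1).congr (Eventually.of_forall fun v => by simp)
  have bound (l : ℝ) (hl : 0 < l) (T : ℝ) :
      ‖f (T / l)‖ ≤ ‖∫ v, 𝓕 ψ v * f ((T - v) / l)‖ + (C / l * B + δ (T / l) * A) := by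
    have hi : Integrable fun v => 𝓕 ψ v * f ((T - v) / l) :=
      (𝓕 ψ).integrable.mul_bdd (c := 1) (hm.comp (by fun_prop)).aestronglyMeasurable
        (Eventually.of_forall fun v => hb _)
    have hc : Integrable fun v => 𝓕 ψ v * f (T / l) := (𝓕 ψ).integrable.mul_const _
    have hsub : f (T / l) - ∫ v, 𝓕 ψ v * f ((T - v) / l) =
        ∫ v, (𝓕 ψ v * f (T / l) - 𝓕 ψ v * f ((T - v) / l)) := by
      rw [integral_sub hc hi, integral_mul_const, ψ.integral_fourier, hψ0, one_mul]
    have hle : ‖f (T / l) - ∫ v, 𝓕 ψ v * f ((T - v) / l)‖ ≤ C / l * B + δ (T / l) * A := by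
      rw [hsub, hA, hB, ← integral_const_mul, ← integral_const_mul, ← integral_add
        (hBi.const_mul _) ((𝓕 ψ).integrable.norm.const_mul _)]
      refine norm_integral_le_of_norm_le ((hBi.const_mul _).add
        ((𝓕 ψ).integrable.norm.const_mul _)) (Eventually.of_forall fun v => ?_)
      rw [← mul_sub, norm_mul]
      refine (mul_le_mul_of_nonneg_left (hf ((T - v) / l) (T / l)) (norm_nonneg _)).trans_eq ?_
      rw [← sub_div, sub_sub_cancel, abs_div, abs_of_pos hl]
      ring
    linarith [norm_le_norm_add_norm_sub' (f (T / l)) (∫ v, 𝓕 ψ v * f ((T - v) / l))]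
  rw [Metric.tendsto_nhds]
  intro ε hε
  obtain ⟨l, hl, hlC⟩ : ∃ l : ℝ, 0 < l ∧ C / l * B < ε / 2 := by
    have : Tendsto (fun l : ℝ => C / l * B) atTop (𝓝 0) := by
      simpa using (tendsto_id.const_div_atTop C).mul_const B
    exact ((eventually_gt_atTop 0).and (this.eventually_lt_const (half_pos hε))).exists
  have hconv : Tendsto (fun T : ℝ => ∫ v, 𝓕 ψ v * f ((T - v) / l)) atTop (𝓝 0) := by
    refine tendsto_integral_fourier_mul_comp_sub (f := fun t => f (t / l))
      (G := fun z => l * G (l * z)) (by fun_prop) (fun _ => hb _)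
      (fun t ht => h0 _ (div_neg_of_neg_of_pos ht hl)) ?_ ?_ ψ hψ
    · refine continuousOn_const.mul (hG.comp (by fun_prop) fun z hz => ?_)
      simpa using mul_nonneg hl.le hz
    · intro z hz
      have h := Measure.integral_comp_div (fun t : ℝ => Complex.exp (-(l * z * t)) * f t) l
      rw [hL _ (by simpa using mul_pos hl hz), abs_of_pos hl, Complex.real_smul] at h
      rw [← h]
      congr 1 with t
      congr 3
      have : (l : ℂ) ≠ 0 := by exact_mod_cast hl.ne'
      push_cast
      field_simp
  have hsum : Tendsto (fun T : ℝ => ‖∫ v, 𝓕 ψ v * f ((T - v) / l)‖ + δ (T / l) * A)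
      atTop (𝓝 0) := by
    simpa using hconv.norm.add ((hδ.comp (tendsto_id.atTop_div_const hl)).mul_const A)
  have hmul : Tendsto (fun T : ℝ => T * l) atTop atTop := tendsto_id.atTop_mul_const hl
  filter_upwards [hmul.eventually (hsum.eventually_lt_const (half_pos hε))] with T hT
  have := bound l hl (T * l)
  rw [mul_div_cancel_right₀ _ hl.ne'] at this hT
  rw [dist_zero_right]
  linarith

open scoped ArithmeticFunction.Moebius

theorem continuousOn_update_inv_riemannZeta :
    ContinuousOn (Function.update (fun s => (riemannZeta s)⁻¹) 1 0) {s | 1 ≤ s.re} := by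
  intro s hs
  refine ContinuousAt.continuousWithinAt ?_
  rcases eq_or_ne s 1 with rfl | hs1
  · rw [continuousAt_update_same]
    have hsub : Tendsto (fun s : ℂ => s - 1) (𝓝[≠] 1) (𝓝 0) :=
      tendsto_nhdsWithin_of_tendsto_nhds (by simpa using (continuous_sub_right (1 : ℂ)).tendsto 1)
    have h := hsub.mul (riemannZeta_residue_one.inv₀ one_ne_zero)
    rw [zero_mul] at h
    refine h.congr' (eventually_nhdsWithin_of_forall fun s hs => ?_)
    have : s - 1 ≠ 0 := sub_ne_zero.2 hs
    rw [mul_inv, mul_inv_cancel_left₀ this]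
  · rw [continuousAt_update_of_ne hs1]
    exact (differentiableAt_riemannZeta hs1).continuousAt.inv₀
      (riemannZeta_ne_zero_of_one_le_re hs)

theorem norm_moebius_le_one (n : ℕ) : ‖(μ n : ℂ)‖ ≤ 1 := by
  rw [Complex.norm_intCast]
  exact_mod_cast ArithmeticFunction.abs_moebius_le_one

theorem norm_sum_moebius_le (n : ℕ) : ‖∑ k ∈ Finset.Icc 1 n, (μ k : ℂ)‖ ≤ n := by
  simpa using norm_sum_le_of_le (Finset.Icc 1 n) fun k _ => norm_moebius_le_one k

theorem norm_sum_moebius_sub_sum_moebius_le {m n : ℕ} (h : m ≤ n) :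
    ‖∑ k ∈ Finset.Icc 1 n, (μ k : ℂ) - ∑ k ∈ Finset.Icc 1 m, (μ k : ℂ)‖ ≤ n - m := by
  induction n, h using Nat.le_induction with
  | base => simp
  | succ n _ ih =>
    rw [Finset.sum_Icc_succ_top (by lia), add_sub_right_comm]
    push_cast
    linarith [norm_add_le_of_le ih (norm_moebius_le_one (n + 1))]

theorem inv_riemannZeta_eq_integral {s : ℂ} (hs : 1 < s.re) :
    (riemannZeta s)⁻¹ = s * ∫ x in Set.Ioi (1 : ℝ),
      (∑ k ∈ Finset.Icc 1 ⌊x⌋₊, (μ k : ℂ)) * (x : ℂ) ^ (-(s + 1)) := by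
  rw [← LSeries_eq_mul_integral' (fun n => (μ n : ℂ)) zero_le_one hs]
  · refine inv_eq_of_mul_eq_one_right ?_
    rw [← LSeries_one_eq_riemannZeta hs]
    exact LSeries_one_mul_Lseries_moebius hs
  · refine Asymptotics.isBigO_of_le _ fun n => ?_
    rw [Real.rpow_one, Real.norm_of_nonneg (by positivity), Real.norm_of_nonneg (by positivity)]
    simpa using Finset.sum_le_sum fun k (_ : k ∈ Finset.Icc 1 n) => norm_moebius_le_one k

theorem norm_normalized_sum_moebius_sub_le {a b : ℝ} (hb : 0 < b) (hab : b ≤ a) :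
    ‖(∑ k ∈ Finset.Icc 1 ⌊a⌋₊, (μ k : ℂ)) / (a : ℂ) -
      (∑ k ∈ Finset.Icc 1 ⌊b⌋₊, (μ k : ℂ)) / (b : ℂ)‖ ≤ 2 * (1 - b / a) + 1 / a := by
  have ha : 0 < a := hb.trans_le hab
  set A := ∑ k ∈ Finset.Icc 1 ⌊a⌋₊, (μ k : ℂ)
  set B := ∑ k ∈ Finset.Icc 1 ⌊b⌋₊, (μ k : ℂ)
  have hB : ‖B‖ ≤ b := (norm_sum_moebius_le _).trans (Nat.floor_le hb.le)
  have hAB : ‖A - B‖ ≤ a - b + 1 := by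
    refine (norm_sum_moebius_sub_sum_moebius_le (Nat.floor_mono hab)).trans ?_
    linarith [Nat.floor_le ha.le, Nat.lt_floor_add_one b]
  have ha' : (a : ℂ) ≠ 0 := by exact_mod_cast ha.ne'
  have hb' : (b : ℂ) ≠ 0 := by exact_mod_cast hb.ne'
  have hsplit : A / (a : ℂ) - B / (b : ℂ) =
      (A - B) / (a : ℂ) - B * ((a - b : ℝ) / (a * b : ℝ) : ℂ) := by
    push_cast
    field_simp
    ring
  rw [hsplit]
  refine (norm_sub_le _ _).trans ?_
  rw [norm_div, norm_mul, norm_div, Complex.norm_of_nonneg ha.le,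
    Complex.norm_of_nonneg (sub_nonneg.2 hab), Complex.norm_of_nonneg (mul_pos ha hb).le]
  calc ‖A - B‖ / a + ‖B‖ * ((a - b) / (a * b))
      ≤ (a - b + 1) / a + b * ((a - b) / (a * b)) := by
        have := div_nonneg (sub_nonneg.2 hab) (mul_pos ha hb).le
        gcongr
    _ = 2 * (1 - b / a) + 1 / a := by
        field_simp
        ring

theorem integral_cexp_neg_mul_sum_moebius {z : ℂ} (hz : 0 < z.re) :
    ∫ t : ℝ, Complex.exp (-(z * t)) *
      ((∑ k ∈ Finset.Icc 1 ⌊Real.exp t⌋₊, (μ k : ℂ)) / (Real.exp t : ℝ)) =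
      (1 + z)⁻¹ * (riemannZeta (1 + z))⁻¹ := by
  have hs : 1 < (1 + z).re := by simpa using hz
  have hne : 1 + z ≠ 0 := fun h => by norm_num [h] at hs
  rw [inv_riemannZeta_eq_integral hs, inv_mul_cancel_left₀ hne]
  have himage : Real.exp '' Set.Ioi 0 = Set.Ioi 1 := by simp
  rw [← himage, integral_image_eq_integral_abs_deriv_smul measurableSet_Ioi
    (fun x _ => (Real.hasDerivAt_exp x).hasDerivWithinAt) Real.exp_injective.injOn,
    ← setIntegral_eq_integral_of_ae_compl_eq_zero (s := Set.Ioi 0)]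
  · refine setIntegral_congr_fun measurableSet_Ioi fun t _ => ?_
    simp only [abs_of_pos (Real.exp_pos t), Complex.real_smul]
    rw [Complex.cpow_def_of_ne_zero (by simp), ← Complex.ofReal_log (Real.exp_pos t).le,
      Real.log_exp, Complex.ofReal_exp, div_eq_mul_inv, ← Complex.exp_neg, mul_left_comm,
      mul_left_comm (Complex.exp t), ← Complex.exp_add, ← Complex.exp_add]
    congr 2
    ring
  · filter_upwards [compl_mem_ae_iff.2 (measure_singleton (0 : ℝ))] with t ht0 ht
    have : t < 0 := lt_of_le_of_ne (not_lt.1 ht) ht0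
    simp [Nat.floor_eq_zero.2 (Real.exp_lt_one_iff.2 this)]

theorem tendsto_sum_moebius_div :
    Tendsto (fun n : ℕ => (∑ k ∈ Finset.Icc 1 n, (μ k : ℝ)) / n) atTop (𝓝 0) := by
  let F : ℝ → ℂ := fun t =>
    (∑ k ∈ Finset.Icc 1 ⌊Real.exp t⌋₊, (μ k : ℂ)) / (Real.exp t : ℝ)
  have hF : Tendsto F atTop (𝓝 0) := by
    refine tendsto_zero_of_laplace_continuousOn (C := 2) (δ := fun t => Real.exp (-t))
      (G := fun z => (1 + z)⁻¹ * Function.update (fun s => (riemannZeta s)⁻¹) 1 0 (1 + z))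
      ?_ (fun t => ?_) (fun t ht => ?_) ?_ (fun z hz => ?_)
      (Real.tendsto_exp_neg_atTop_nhds_zero) fun s t => ?_
    · have hS : Measurable fun n : ℕ => ∑ k ∈ Finset.Icc 1 n, (μ k : ℂ) := measurable_of_countable _
      exact (hS.comp (Nat.measurable_floor.comp Real.measurable_exp)).div (by fun_prop)
    · rw [norm_div, Complex.norm_of_nonneg (Real.exp_pos t).le, div_le_one (Real.exp_pos t)]
      exact (norm_sum_moebius_le _).trans (Nat.floor_le (Real.exp_pos t).le)
    · simp [F, Nat.floor_eq_zero.2 (Real.exp_lt_one_iff.2 ht)]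
    · refine ContinuousOn.mul (ContinuousOn.inv₀ (by fun_prop) fun z hz h => ?_)
        (continuousOn_update_inv_riemannZeta.comp (by fun_prop) fun z hz => ?_)
      · have := congrArg Complex.re h
        simp only [Complex.add_re, Complex.one_re, Complex.zero_re] at this
        linarith [show 0 ≤ z.re from hz]
      · simpa using hz
    · rw [integral_cexp_neg_mul_sum_moebius hz, Function.update_of_ne]
      intro h
      simp [add_eq_left.1 h] at hz
    · have hexp (u v : ℝ) (huv : u ≤ v) :
          2 * (1 - Real.exp u / Real.exp v) ≤ 2 * |v - u| := by
        rw [← Real.exp_sub, abs_of_nonneg (sub_nonneg.2 huv)]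
        linarith [Real.add_one_le_exp (u - v)]
      rcases le_total s t with h | h
      · have h1 := norm_normalized_sum_moebius_sub_le (Real.exp_pos s) (Real.exp_le_exp.2 h)
        rw [one_div, ← Real.exp_neg] at h1
        linarith [hexp s t h]
      · have h1 := norm_normalized_sum_moebius_sub_le (Real.exp_pos t) (Real.exp_le_exp.2 h)
        rw [one_div, ← Real.exp_neg] at h1
        rw [norm_sub_rev, abs_sub_comm]
        linarith [hexp t s h, Real.exp_le_exp.2 (neg_le_neg h)]
  have h := hF.comp (Real.tendsto_log_atTop.comp tendsto_natCast_atTop_atTop)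
  rw [tendsto_zero_iff_norm_tendsto_zero] at h ⊢
  refine h.congr' ?_
  filter_upwards [eventually_gt_atTop 0] with n hn
  have hn' : (0 : ℝ) < n := by exact_mod_cast hn
  simp only [Function.comp_apply, F, Real.exp_log hn', Nat.floor_natCast]
  rw [← Complex.norm_real]
  push_cast
  rfl

theorem sum_moebius_of_sq_dvd {N n : ℕ} (hn : n ≠ 0) (hN : n ≤ N) :
    ∑ d ∈ (Finset.Icc 1 N).filter (fun d => d ^ 2 ∣ n), μ d = if Squarefree n then 1 else 0 := by
  obtain ⟨a, b, rfl, ha⟩ := Nat.sq_mul_squarefree n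
  have hb : b ≠ 0 := by rintro rfl; simp at hn
  have ha0 : a ≠ 0 := ha.ne_zero
  have hdvd (d : ℕ) : d ^ 2 ∣ b ^ 2 * a ↔ d ∣ b := by
    refine ⟨fun h => ?_, fun h => (pow_dvd_pow_of_dvd h 2).mul_right a⟩
    obtain ⟨d', b', hcop, hd, hb'⟩ := Nat.exists_coprime d b
    have hg : 0 < d.gcd b := Nat.gcd_pos_of_pos_right d (Nat.pos_of_ne_zero hb)
    have h' : d' ^ 2 * d.gcd b ^ 2 ∣ b' ^ 2 * a * d.gcd b ^ 2 := by
      rwa [← mul_pow, ← hd, mul_right_comm, ← mul_pow, ← hb']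
    have hda : d' ^ 2 ∣ a := (hcop.pow 2 2).dvd_of_dvd_mul_left
      (Nat.dvd_of_mul_dvd_mul_right (pow_pos hg 2) h')
    have hd1 : d' = 1 := Nat.isUnit_iff.1 (ha d' (by rwa [← sq]))
    rw [hd, hd1, one_mul]
    exact Nat.gcd_dvd_right d b
  have hset : (Finset.Icc 1 N).filter (fun d => d ^ 2 ∣ b ^ 2 * a) = b.divisors := by
    ext d
    simp only [Finset.mem_filter, Finset.mem_Icc, hdvd, Nat.mem_divisors]
    refine ⟨fun h => ⟨h.2, hb⟩, fun h => ⟨⟨Nat.pos_of_dvd_of_pos h.1 (Nat.pos_of_ne_zero hb), ?_⟩,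
      h.1⟩⟩
    exact (Nat.le_of_dvd (Nat.pos_of_ne_zero hn)
      ((h.1.trans (dvd_pow_self b two_ne_zero)).mul_right a)).trans hN
  have hsq : Squarefree (b ^ 2 * a) ↔ b = 1 := by
    refine ⟨fun h => ?_, fun h => by simpa [h] using ha⟩
    exact Nat.isUnit_iff.1 (h b ⟨a, by ring⟩)
  rw [hset, ← ArithmeticFunction.coe_mul_zeta_apply, ArithmeticFunction.moebius_mul_coe_zeta,
    ArithmeticFunction.one_apply]
  simp only [hsq]

theorem card_squarefree_eq_sum_moebius_mul_floor (n : ℕ) :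
    (((Finset.Icc 1 n).filter Squarefree).card : ℤ) =
      ∑ d ∈ Finset.Icc 1 n, μ d * (n / d ^ 2 : ℕ) := by
  rw [Finset.card_filter]
  push_cast
  calc ∑ i ∈ Finset.Icc 1 n, (if Squarefree i then (1 : ℤ) else 0)
      = ∑ i ∈ Finset.Icc 1 n, ∑ d ∈ Finset.Icc 1 n, if d ^ 2 ∣ i then μ d else 0 := by
        refine Finset.sum_congr rfl fun i hi => ?_
        rw [Finset.mem_Icc] at hi
        rw [← sum_moebius_of_sq_dvd (by lia) hi.2, Finset.sum_filter]
    _ = ∑ d ∈ Finset.Icc 1 n, μ d * (n / d ^ 2 : ℕ) := by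
        rw [Finset.sum_comm]
        refine Finset.sum_congr rfl fun d _ => ?_
        rw [← Finset.sum_filter, Finset.sum_const, nsmul_eq_mul, mul_comm,
          ← Nat.Ioc_filter_dvd_card_eq_div]
        rfl

theorem tsum_moebius_div_sq : ∑' d : ℕ, (μ d : ℝ) / d ^ 2 = 6 / π ^ 2 := by
  have h2 : 1 < (2 : ℂ).re := by norm_num
  have h := LSeries_one_mul_Lseries_moebius h2
  rw [LSeries_one_eq_riemannZeta h2, riemannZeta_two] at h
  have hpi : (π : ℂ) ≠ 0 := by exact_mod_cast Real.pi_ne_zero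
  have hL : LSeries (fun n => (μ n : ℂ)) 2 = ((∑' d : ℕ, (μ d : ℝ) / d ^ 2 : ℝ) : ℂ) := by
    rw [LSeries, Complex.ofReal_tsum]
    refine tsum_congr fun d => ?_
    rcases eq_or_ne d 0 with rfl | hd
    · simp
    · rw [LSeries.term_of_ne_zero hd, Complex.cpow_ofNat]
      push_cast
      rfl
  rw [hL] at h
  have h' : (π ^ 2 / 6 : ℝ) * (∑' d : ℕ, (μ d : ℝ) / d ^ 2) = 1 := by exact_mod_cast h
  rw [eq_div_iff (by positivity)]
  linarith

theorem tendsto_card_squarefree_div :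
    Tendsto (fun n : ℕ => (((Finset.Icc 1 n).filter Squarefree).card : ℝ) / n)
      atTop (𝓝 (6 / π ^ 2)) := by
  rw [← tsum_moebius_div_sq]
  have hsum (n : ℕ) : (((Finset.Icc 1 n).filter Squarefree).card : ℝ) / n =
      ∑' d : ℕ, (μ d : ℝ) * ((n / d ^ 2 : ℕ) / n : ℝ) := by
    rw [tsum_eq_sum (s := Finset.Icc 1 n)]
    · simp_rw [← mul_div_assoc]
      rw [← Finset.sum_div]
      congr 1
      have h := congrArg (Int.cast : ℤ → ℝ) (card_squarefree_eq_sum_moebius_mul_floor n)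
      push_cast at h
      exact h
    · intro d hd
      rcases eq_or_ne d 0 with rfl | hd0
      · simp
      · have hlt : n < d := by simpa [Nat.one_le_iff_ne_zero, hd0] using hd
        rw [Nat.div_eq_of_lt (hlt.trans_le (Nat.le_self_pow two_ne_zero d))]
        simp
  simp_rw [hsum]
  have hmu (d : ℕ) : ‖(μ d : ℝ)‖ ≤ 1 := by
    rw [Real.norm_eq_abs]
    exact_mod_cast ArithmeticFunction.abs_moebius_le_one
  refine tendsto_tsum_of_dominated_convergence (bound := fun d : ℕ => 1 / (d : ℝ) ^ 2)
    (Real.summable_one_div_nat_pow.2 one_lt_two) (fun d => ?_)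
    (Eventually.of_forall fun n d => ?_)
  · have h := (tendsto_nat_floor_mul_div_atTop (R := ℝ) (a := 1 / (d : ℝ) ^ 2)
      (by positivity)).comp tendsto_natCast_atTop_atTop
    rw [← mul_one_div]
    refine (h.const_mul _).congr fun n => ?_
    simp only [Function.comp_apply, one_div_mul_eq_div]
    rw [← Nat.floor_div_eq_div (K := ℝ)]
    push_cast
    rfl
  · rw [norm_mul, Real.norm_of_nonneg (by positivity : (0 : ℝ) ≤ (n / d ^ 2 : ℕ) / n)]
    refine (mul_le_of_le_one_left (by positivity) (hmu d)).trans ?_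
    refine div_le_of_le_mul₀ (by positivity) (by positivity) ?_
    refine Nat.cast_div_le.trans_eq ?_
    push_cast
    ring

theorem moebius_eq_neg_one_density :
    Tendsto (fun n : ℕ =>
      (((Finset.Icc 1 n).filter (fun i => ArithmeticFunction.moebius i = -1)).card : ℝ) / n)
      atTop (nhds (3 / π ^ 2)) := by
  have h := (tendsto_card_squarefree_div.sub tendsto_sum_moebius_div).div_const 2
  rw [sub_zero, div_div, mul_comm, ← div_div, show (6 : ℝ) / 2 = 3 by norm_num] at h
  refine h.congr fun n => ?_
  rw [← sub_div, div_right_comm]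
  congr 1
  rw [Finset.card_filter, Finset.card_filter]
  push_cast
  rw [← Finset.sum_sub_distrib, Finset.sum_div]
  refine Finset.sum_congr rfl fun i _ => ?_
  by_cases hi : Squarefree i
  · rcases ArithmeticFunction.moebius_ne_zero_iff_eq_or.1
      (ArithmeticFunction.moebius_ne_zero_iff_squarefree.2 hi) with h | h <;> norm_num [hi, h]
  · simp [hi, ArithmeticFunction.moebius_eq_zero_of_not_squarefree hi]
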